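/- Let U be the unitary operator on L²(ℝ²ⁿ) acting on Schwartz functions by UΦ(x,p) = (2π)^{-n/2} ∫ e^{iξ·p} ℱ_pΦ(x − ξ/2, x + ξ/2) dξ. Then for every Ψ ∈ 𝒮(ℝ²ⁿ) and every j = 1,…,n, the following conjugation identities hold (Bopp shifts): U(x_j · U^{-1}Ψ) = x_j Ψ + (i/2) ∂Ψ/∂p_j; U(p_j · U^{-1}Ψ) = p_j Ψ + (i/2) ∂Ψ/∂x_j; U(−i ∂/∂x_j (U^{-1}Ψ)) = p_j Ψ − (i/2) ∂Ψ/∂x_j; U(−i ∂/∂p_j (U^{-1}Ψ)) = x_j Ψ − (i/2) ∂Ψ/∂p_j. -/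

import Mathlib

open MeasureTheory Complex ComplexConjugate ENNReal

noncomputable section

/-- Configuration space ℝⁿ. -/
abbrev Cfg (n : ℕ) := Fin n → ℝ

/-- Phase space ℝ²ⁿ = ℝⁿ × ℝⁿ. -/
abbrev Phase (n : ℕ) := (Fin n → ℝ) × (Fin n → ℝ)

/-- Euclidean dot product on ℝⁿ. -/
def dotp (n : ℕ) (a b : Cfg n) : ℝ := ∑ i, a i * b i

/-- Partial Fourier transform in the p-variable. -/
def Fp (n : ℕ) (Ψ : Phase n → ℂ) : Phase n → ℂ :=
  fun w => ((Real.sqrt ((2 * Real.pi) ^ n) : ℝ) : ℂ)⁻¹ *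
    ∫ p : Cfg n, Complex.exp (-(Complex.I * ((dotp n w.2 p : ℝ) : ℂ))) * Ψ (w.1, p)

/-- The operator U = U_D(−ln√2) ∘ U_R(−π/4), acting on Schwartz functions by
UΦ(x,p) = (2π)^{-n/2} ∫ e^{iξ·p} ℱ_pΦ(x − ξ/2, x + ξ/2) dξ. -/
def Uact (n : ℕ) (Φ : Phase n → ℂ) : Phase n → ℂ :=
  fun zp => ((Real.sqrt ((2 * Real.pi) ^ n) : ℝ) : ℂ)⁻¹ *
    ∫ ξ : Cfg n, Complex.exp (Complex.I * ((dotp n ξ zp.2 : ℝ) : ℂ)) *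
      Fp n Φ (zp.1 - (1 / 2 : ℝ) • ξ, zp.1 + (1 / 2 : ℝ) • ξ)

open scoped LineDeriv

lemma dotp_comm (n : ℕ) (a b : Cfg n) : dotp n a b = dotp n b a := by
  simp only [dotp, mul_comm]

lemma dotp_add_smul_single (n : ℕ) (a b : Cfg n) (j : Fin n) (t : ℝ) :
    dotp n a (b + t • Pi.single j 1) = dotp n a b + t * a j := by
  simp [dotp, mul_add, Finset.sum_add_distrib, Pi.single_apply, mul_comm]

lemma dotp_add_smul_single_left (n : ℕ) (a b : Cfg n) (j : Fin n) (t : ℝ) :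
    dotp n (a + t • Pi.single j 1) b = dotp n a b + t * b j := by
  rw [dotp_comm, dotp_add_smul_single, dotp_comm]

lemma continuous_dotp (n : ℕ) : Continuous fun w : Cfg n × Cfg n => dotp n w.1 w.2 := by
  unfold dotp
  fun_prop

lemma update_eq_add_smul_single {n : ℕ} (x : Cfg n) (j : Fin n) (t : ℝ) :
    Function.update x j t = x + (t - x j) • Pi.single j (1 : ℝ) := by
  ext i
  by_cases h : i = j
  · subst h; simp
  · simp [h]

/-- The weight `(1 + ‖a‖)^{-(n+1)}`, integrable on `ℝⁿ`. -/
def decayWeight (n : ℕ) (a : Cfg n) : ℝ := ((1 + ‖a‖) ^ (n + 1))⁻¹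

lemma decayWeight_nonneg {n : ℕ} (a : Cfg n) : 0 ≤ decayWeight n a := by
  unfold decayWeight; positivity

lemma decayWeight_le_one {n : ℕ} (a : Cfg n) : decayWeight n a ≤ 1 := by
  unfold decayWeight
  exact inv_le_one_of_one_le₀ (one_le_pow₀ (by linarith [norm_nonneg a]))

lemma integrable_decayWeight (n : ℕ) : Integrable (decayWeight n) := by
  have h := integrable_one_add_norm (E := Cfg n) (μ := volume) (r := ((n + 1 : ℕ) : ℝ))
    (by simp)
  refine h.congr (.of_forall fun a => ?_)
  have ha : 0 ≤ 1 + ‖a‖ := by positivity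
  simp only [decayWeight, Real.rpow_neg ha, Real.rpow_natCast]

lemma decayWeight_le_of_norm_le {n : ℕ} {a b : Cfg n} {R : ℝ} (h : 1 + ‖b‖ ≤ R * (1 + ‖a‖)) :
    decayWeight n a ≤ R ^ (n + 1) * decayWeight n b := by
  unfold decayWeight
  have ha : 0 < 1 + ‖a‖ := by positivity
  have hb : 0 < 1 + ‖b‖ := by positivity
  rw [← div_eq_mul_inv, inv_eq_one_div, div_le_div_iff₀ (by positivity) (by positivity), one_mul,
    ← mul_pow]
  gcongr

lemma SchwartzMap.exists_norm_le_decayWeight {n : ℕ} (Φ : SchwartzMap (Phase n) ℂ) :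
    ∃ C, 0 ≤ C ∧ ∀ a p, ‖Φ (a, p)‖ ≤ C * (decayWeight n a * decayWeight n p) := by
  refine ⟨2 ^ (2 * (n + 1)) *
    (Finset.Iic (2 * (n + 1), 0)).sup (fun m => SchwartzMap.seminorm ℝ m.1 m.2) Φ,
    by positivity, fun a p => ?_⟩
  have h := SchwartzMap.one_add_le_sup_seminorm_apply (𝕜 := ℝ) (m := (2 * (n + 1), 0))
    (k := 2 * (n + 1)) (n := 0) le_rfl le_rfl Φ (a, p)
  rw [norm_iteratedFDeriv_zero] at h
  have ha : 1 + ‖a‖ ≤ 1 + ‖(a, p)‖ := by simp [Prod.norm_def]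
  have hp : 1 + ‖p‖ ≤ 1 + ‖(a, p)‖ := by simp [Prod.norm_def]
  have h2 : (1 + ‖a‖) ^ (n + 1) * (1 + ‖p‖) ^ (n + 1) ≤ (1 + ‖(a, p)‖) ^ (2 * (n + 1)) := by
    rw [two_mul, pow_add _ (n + 1) (n + 1)]; gcongr
  unfold decayWeight
  rw [← mul_inv, ← div_eq_mul_inv, le_div_iff₀ (by positivity), mul_comm]
  exact (mul_le_mul_of_nonneg_right h2 (norm_nonneg _)).trans h

lemma norm_exp_I_mul (r : ℝ) : ‖exp (I * (r : ℂ))‖ = 1 := by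
  rw [mul_comm, norm_exp_ofReal_mul_I]

lemma norm_exp_neg_I_mul (r : ℝ) : ‖exp (-(I * (r : ℂ)))‖ = 1 := by
  rw [← mul_neg, ← ofReal_neg, norm_exp_I_mul]

/-- The integrand of the partial Fourier transform of `Φ`. -/
def fpIntegrand (n : ℕ) (Φ : Phase n → ℂ) (w : Phase n) (p : Cfg n) : ℂ :=
  exp (-(I * ((dotp n w.2 p : ℝ) : ℂ))) * Φ (w.1, p)

lemma norm_fpIntegrand {n : ℕ} (Φ : Phase n → ℂ) (w : Phase n) (p : Cfg n) :
    ‖fpIntegrand n Φ w p‖ = ‖Φ (w.1, p)‖ := by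
  rw [fpIntegrand, norm_mul, norm_exp_neg_I_mul, one_mul]

lemma continuous_fpIntegrand {n : ℕ} (Φ : SchwartzMap (Phase n) ℂ) :
    Continuous fun z : Phase n × Cfg n => fpIntegrand n Φ z.1 z.2 := by
  have h1 : Continuous fun z : Phase n × Cfg n => dotp n z.1.2 z.2 :=
    (continuous_dotp n).comp (f := fun z : Phase n × Cfg n => (z.1.2, z.2)) (by fun_prop)
  have h2 : Continuous fun z : Phase n × Cfg n => Φ (z.1.1, z.2) :=
    Φ.continuous.comp (by fun_prop)
  unfold fpIntegrand
  fun_prop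

lemma integrable_fpIntegrand {n : ℕ} (Φ : SchwartzMap (Phase n) ℂ) (w : Phase n) :
    Integrable (fpIntegrand n Φ w) := by
  obtain ⟨C, hC, h⟩ := Φ.exists_norm_le_decayWeight
  refine ((integrable_decayWeight n).const_mul C).mono'
    ((continuous_fpIntegrand Φ).comp (Continuous.prodMk_right w)).aestronglyMeasurable
    (.of_forall fun p => ?_)
  rw [norm_fpIntegrand]
  refine (h w.1 p).trans ?_
  gcongr
  exact mul_le_of_le_one_left (decayWeight_nonneg p) (decayWeight_le_one _)

lemma exists_norm_Fp_le {n : ℕ} (Φ : SchwartzMap (Phase n) ℂ) :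
    ∃ C, 0 ≤ C ∧ ∀ w, ‖Fp n Φ w‖ ≤ C * decayWeight n w.1 := by
  obtain ⟨C, hC, h⟩ := Φ.exists_norm_le_decayWeight
  have hI : 0 ≤ ∫ p, decayWeight n p := integral_nonneg fun p => decayWeight_nonneg p
  refine ⟨‖((Real.sqrt ((2 * Real.pi) ^ n) : ℝ) : ℂ)⁻¹‖ * (C * ∫ p, decayWeight n p),
    by positivity, fun w => ?_⟩
  rw [Fp, norm_mul, mul_assoc]
  gcongr
  calc ‖∫ p, fpIntegrand n Φ w p‖ ≤ ∫ p, C * decayWeight n w.1 * decayWeight n p := by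
        refine norm_integral_le_of_norm_le ((integrable_decayWeight n).const_mul _)
          (.of_forall fun p => ?_)
        rw [norm_fpIntegrand, mul_assoc]
        exact h w.1 p
    _ = _ := by rw [integral_const_mul]; ring

lemma stronglyMeasurable_Fp {n : ℕ} (Φ : SchwartzMap (Phase n) ℂ) :
    StronglyMeasurable (Fp n Φ) :=
  StronglyMeasurable.const_mul
    (continuous_fpIntegrand Φ).stronglyMeasurable.integral_prod_right' _

/-- Multiplication by the coordinate `x_j` on Schwartz functions. -/
def mulX {n : ℕ} (j : Fin n) (Φ : SchwartzMap (Phase n) ℂ) : SchwartzMap (Phase n) ℂ :=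
  SchwartzMap.smulLeftCLM ℂ (fun w : Phase n => w.1 j) Φ

/-- Multiplication by the coordinate `p_j` on Schwartz functions. -/
def mulP {n : ℕ} (j : Fin n) (Φ : SchwartzMap (Phase n) ℂ) : SchwartzMap (Phase n) ℂ :=
  SchwartzMap.smulLeftCLM ℂ (fun w : Phase n => w.2 j) Φ

/-- The partial derivative `∂/∂x_j` on Schwartz functions. -/
def derivX {n : ℕ} (j : Fin n) (Φ : SchwartzMap (Phase n) ℂ) : SchwartzMap (Phase n) ℂ :=
  ∂_{((Pi.single j 1, 0) : Phase n)} Φ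

/-- The partial derivative `∂/∂p_j` on Schwartz functions. -/
def derivP {n : ℕ} (j : Fin n) (Φ : SchwartzMap (Phase n) ℂ) : SchwartzMap (Phase n) ℂ :=
  ∂_{((0, Pi.single j 1) : Phase n)} Φ

lemma mulX_apply {n : ℕ} (j : Fin n) (Φ : SchwartzMap (Phase n) ℂ) (w : Phase n) :
    mulX j Φ w = (w.1 j : ℂ) * Φ w := by
  have h : Function.HasTemperateGrowth fun w : Phase n => w.1 j :=
    ((ContinuousLinearMap.proj (R := ℝ) (φ := fun _ : Fin n => ℝ) j).comp
      (ContinuousLinearMap.fst ℝ (Cfg n) (Cfg n))).hasTemperateGrowth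
  rw [mulX, SchwartzMap.smulLeftCLM_apply_apply h, real_smul]

lemma mulP_apply {n : ℕ} (j : Fin n) (Φ : SchwartzMap (Phase n) ℂ) (w : Phase n) :
    mulP j Φ w = (w.2 j : ℂ) * Φ w := by
  have h : Function.HasTemperateGrowth fun w : Phase n => w.2 j :=
    ((ContinuousLinearMap.proj (R := ℝ) (φ := fun _ : Fin n => ℝ) j).comp
      (ContinuousLinearMap.snd ℝ (Cfg n) (Cfg n))).hasTemperateGrowth
  rw [mulP, SchwartzMap.smulLeftCLM_apply_apply h, real_smul]

lemma hasDerivAt_schwartz_smul_single {n : ℕ} (Φ : SchwartzMap (Phase n) ℂ) (j : Fin n)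
    (α β : ℝ) (a b : Cfg n) (t : ℝ) :
    HasDerivAt (fun t : ℝ => Φ (a + (t * α) • Pi.single j 1, b + (t * β) • Pi.single j 1))
      (α * derivX j Φ (a + (t * α) • Pi.single j 1, b + (t * β) • Pi.single j 1) +
        β * derivP j Φ (a + (t * α) • Pi.single j 1, b + (t * β) • Pi.single j 1)) t := by
  have hγ : HasDerivAt
      (fun t : ℝ => ((a + (t * α) • Pi.single j 1, b + (t * β) • Pi.single j 1) : Phase n))
      (α • ((Pi.single j 1, 0) : Phase n) + β • ((0, Pi.single j 1) : Phase n)) t := by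
    convert ((((hasDerivAt_id t).mul_const α).smul_const
      (Pi.single j 1 : Cfg n)).const_add a).prodMk
      ((((hasDerivAt_id t).mul_const β).smul_const (Pi.single j 1 : Cfg n)).const_add b) using 1
    · rfl
    · simp
  have h := (Φ.differentiableAt.hasFDerivAt).comp_hasDerivAt t hγ
  rw [map_add, map_smul, map_smul, real_smul, real_smul] at h
  exact h

lemma integral_mul_hasLineDerivAt_of_eigen {n : ℕ} {θ g g' : Cfg n → ℂ} {κ : ℂ} {v : Cfg n}
    (hθ : ∀ p, HasLineDerivAt ℝ θ (κ * θ p) p v) (hg : ∀ p, HasLineDerivAt ℝ g (g' p) p v)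
    (hi : Integrable fun p => θ p * g p) (hi' : Integrable fun p => θ p * g' p) :
    ∫ p, θ p * g' p = -κ * ∫ p, θ p * g p := by
  have h := integral_bilinear_hasLineDerivAt_right_eq_neg_left_of_integrable (μ := volume)
    (B := ContinuousLinearMap.mul ℝ ℂ) (f := θ) (f' := fun p => κ * θ p) (g := g) (g' := g')
    (v := v) (by simpa [mul_assoc] using hi.const_mul κ) hi' hi
    (fun p _ => hθ p) (fun p _ => hg p)
  simpa [mul_assoc, integral_const_mul] using h

lemma Fp_mulX {n : ℕ} (j : Fin n) (Φ : SchwartzMap (Phase n) ℂ) (w : Phase n) :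
    Fp n (mulX j Φ) w = (w.1 j : ℂ) * Fp n Φ w := by
  simp only [Fp, mulX_apply, mul_left_comm _ (w.1 j : ℂ), integral_const_mul]

lemma hasDerivAt_exp_I_mul (c d : ℝ) (t : ℝ) :
    HasDerivAt (fun t : ℝ => exp (I * ((c + t * d : ℝ) : ℂ)))
      (I * d * exp (I * ((c + t * d : ℝ) : ℂ))) t := by
  have h : HasDerivAt (fun t : ℝ => c + t * d) d t := by
    simpa using ((hasDerivAt_id t).mul_const d).const_add c
  convert (h.ofReal_comp.const_mul I).cexp using 1
  ring

lemma hasDerivAt_exp_neg_I_mul (c d : ℝ) (t : ℝ) :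
    HasDerivAt (fun t : ℝ => exp (-(I * ((c + t * d : ℝ) : ℂ))))
      (-(I * d) * exp (-(I * ((c + t * d : ℝ) : ℂ)))) t := by
  convert hasDerivAt_exp_I_mul (-c) (-d) t using 1
  · ext s; push_cast; ring_nf
  · push_cast; ring_nf

lemma Fp_derivP {n : ℕ} (j : Fin n) (Φ : SchwartzMap (Phase n) ℂ) (w : Phase n) :
    Fp n (derivP j Φ) w = I * (w.2 j : ℂ) * Fp n Φ w := by
  have h := integral_mul_hasLineDerivAt_of_eigen
    (θ := fun p => exp (-(I * ((dotp n w.2 p : ℝ) : ℂ)))) (κ := -(I * w.2 j))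
    (v := Pi.single j 1) (g := fun p => Φ (w.1, p)) (g' := fun p => derivP j Φ (w.1, p))
    (fun p => by
      have := hasDerivAt_exp_neg_I_mul (dotp n w.2 p) (w.2 j) 0
      simpa only [HasLineDerivAt, dotp_add_smul_single, zero_mul, add_zero] using this)
    (fun p => by
      have := hasDerivAt_schwartz_smul_single Φ j 0 1 w.1 p 0
      simpa [HasLineDerivAt] using this)
    (integrable_fpIntegrand Φ w) (integrable_fpIntegrand (derivP j Φ) w)
  rw [Fp, h, Fp]
  ring

lemma hasDerivAt_fpIntegrand {n : ℕ} (Φ : SchwartzMap (Phase n) ℂ) (j : Fin n)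
    (α β : ℝ) (a b p : Cfg n) (t : ℝ) :
    HasDerivAt (fun t : ℝ =>
        fpIntegrand n Φ (a + (t * α) • Pi.single j 1, b + (t * β) • Pi.single j 1) p)
      (α * fpIntegrand n (derivX j Φ)
          (a + (t * α) • Pi.single j 1, b + (t * β) • Pi.single j 1) p -
        I * β * fpIntegrand n (mulP j Φ)
          (a + (t * α) • Pi.single j 1, b + (t * β) • Pi.single j 1) p) t := by
  have h1 := hasDerivAt_exp_neg_I_mul (dotp n b p) (β * p j) t
  have h2 := hasDerivAt_schwartz_smul_single Φ j α 0 a p t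
  simp only [mul_zero, zero_smul, add_zero, Complex.ofReal_zero, zero_mul] at h2
  simp only [fpIntegrand, dotp_add_smul_single_left, mulP_apply, mul_assoc]
  refine (h1.mul h2).congr_deriv ?_
  push_cast
  ring

lemma hasDerivAt_Fp {n : ℕ} (Φ : SchwartzMap (Phase n) ℂ) (j : Fin n)
    (α β : ℝ) (a b : Cfg n) (t : ℝ) :
    HasDerivAt (fun t : ℝ =>
        Fp n Φ (a + (t * α) • Pi.single j 1, b + (t * β) • Pi.single j 1))
      (α * Fp n (derivX j Φ) (a + (t * α) • Pi.single j 1, b + (t * β) • Pi.single j 1) -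
        I * β * Fp n (mulP j Φ)
          (a + (t * α) • Pi.single j 1, b + (t * β) • Pi.single j 1)) t := by
  obtain ⟨C₁, hC₁, h₁⟩ := (derivX j Φ).exists_norm_le_decayWeight
  obtain ⟨C₂, hC₂, h₂⟩ := (mulP j Φ).exists_norm_le_decayWeight
  have hi₁ := integrable_fpIntegrand (derivX j Φ)
    (a + (t * α) • Pi.single j 1, b + (t * β) • Pi.single j 1)
  have hi₂ := integrable_fpIntegrand (mulP j Φ)
    (a + (t * α) • Pi.single j 1, b + (t * β) • Pi.single j 1)
  have h := (hasDerivAt_integral_of_dominated_loc_of_deriv_le (μ := volume) (x₀ := t)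
    (bound := fun p => (|α| * C₁ + |β| * C₂) * decayWeight n p)
    Filter.univ_mem
    (.of_forall fun s => (integrable_fpIntegrand Φ _).aestronglyMeasurable)
    (integrable_fpIntegrand Φ _)
    ((hi₁.const_mul (α : ℂ)).sub (hi₂.const_mul (I * β))).aestronglyMeasurable
    (.of_forall fun p s _ => ?_) ((integrable_decayWeight n).const_mul _)
    (.of_forall fun p s _ => hasDerivAt_fpIntegrand Φ j α β a b p s)).2
  · rw [integral_sub (hi₁.const_mul _) (hi₂.const_mul _), integral_const_mul,
      integral_const_mul] at h
    refine (h.const_mul ((Real.sqrt ((2 * Real.pi) ^ n) : ℝ) : ℂ)⁻¹).congr_deriv ?_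
    simp only [Fp, fpIntegrand]
    ring
  · refine (norm_sub_le _ _).trans ?_
    simp only [norm_mul, norm_fpIntegrand, norm_I, one_mul, norm_real, Real.norm_eq_abs]
    have hw : ∀ {C : ℝ} (_ : 0 ≤ C) (a : Cfg n),
        C * (decayWeight n a * decayWeight n p) ≤ C * decayWeight n p := fun hC a =>
      mul_le_mul_of_nonneg_left
        (mul_le_of_le_one_left (decayWeight_nonneg p) (decayWeight_le_one a)) hC
    rw [add_mul, mul_assoc, mul_assoc]
    gcongr
    · exact (h₁ _ _).trans (hw hC₁ _)
    · exact (h₂ _ _).trans (hw hC₂ _)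

/-- The integrand of `Uact`. -/
def uIntegrand (n : ℕ) (Φ : Phase n → ℂ) (z : Phase n) (ξ : Cfg n) : ℂ :=
  exp (I * ((dotp n ξ z.2 : ℝ) : ℂ)) *
    Fp n Φ (z.1 - (1 / 2 : ℝ) • ξ, z.1 + (1 / 2 : ℝ) • ξ)

lemma exists_norm_uIntegrand_le {n : ℕ} (Φ : SchwartzMap (Phase n) ℂ) :
    ∃ C, 0 ≤ C ∧ ∀ z ξ, ‖uIntegrand n Φ z ξ‖ ≤
      C * (2 * (1 + ‖z.1‖)) ^ (n + 1) * decayWeight n ξ := by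
  obtain ⟨C, hC, h⟩ := exists_norm_Fp_le Φ
  refine ⟨C, hC, fun z ξ => ?_⟩
  rw [uIntegrand, norm_mul, norm_exp_I_mul, one_mul, mul_assoc]
  refine (h _).trans (mul_le_mul_of_nonneg_left (decayWeight_le_of_norm_le ?_) hC)
  have h1 : ‖ξ‖ ≤ 2 * (‖z.1‖ + ‖z.1 - (1 / 2 : ℝ) • ξ‖) := by
    have h2 : ξ = (2 : ℝ) • (z.1 - (z.1 - (1 / 2 : ℝ) • ξ)) := by
      module
    conv_lhs => rw [h2, norm_smul, Real.norm_ofNat]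
    gcongr
    exact norm_sub_le _ _
  nlinarith [norm_nonneg z.1, norm_nonneg (z.1 - (1 / 2 : ℝ) • ξ),
    mul_nonneg (norm_nonneg z.1) (norm_nonneg (z.1 - (1 / 2 : ℝ) • ξ))]

lemma aestronglyMeasurable_uIntegrand {n : ℕ} (Φ : SchwartzMap (Phase n) ℂ) (z : Phase n) :
    AEStronglyMeasurable (uIntegrand n Φ z) := by
  have h1 : Continuous fun ξ : Cfg n => dotp n ξ z.2 :=
    (continuous_dotp n).comp (f := fun ξ : Cfg n => (ξ, z.2)) (by fun_prop)
  have h2 : Continuous fun ξ : Cfg n => exp (I * ((dotp n ξ z.2 : ℝ) : ℂ)) := by fun_prop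
  have h3 : Measurable fun ξ : Cfg n =>
      ((z.1 - (1 / 2 : ℝ) • ξ, z.1 + (1 / 2 : ℝ) • ξ) : Phase n) :=
    Continuous.measurable (by fun_prop)
  exact (h2.stronglyMeasurable.mul
    ((stronglyMeasurable_Fp Φ).comp_measurable h3)).aestronglyMeasurable

lemma integrable_uIntegrand {n : ℕ} (Φ : SchwartzMap (Phase n) ℂ) (z : Phase n) :
    Integrable (uIntegrand n Φ z) := by
  obtain ⟨C, -, h⟩ := exists_norm_uIntegrand_le Φ
  exact ((integrable_decayWeight n).const_mul _).mono' (aestronglyMeasurable_uIntegrand Φ z)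
    (.of_forall (h z))

lemma Uact_const_mul {n : ℕ} (c : ℂ) (Φ : Phase n → ℂ) (z : Phase n) :
    Uact n (fun w => c * Φ w) z = c * Uact n Φ z := by
  simp only [Uact, Fp, mul_left_comm _ c, integral_const_mul]

lemma hasDerivAt_Uact_comp {n : ℕ} (Φ Φ₁ Φ₂ : SchwartzMap (Phase n) ℂ) (γ : ℝ → Phase n)
    {R : ℝ} (hγ : ∀ s ∈ Metric.ball (0 : ℝ) 1, ‖(γ s).1‖ ≤ R)
    (hd : ∀ ξ s, HasDerivAt (fun t => uIntegrand n Φ (γ t) ξ)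
      (uIntegrand n Φ₁ (γ s) ξ - I * uIntegrand n Φ₂ (γ s) ξ) s) :
    HasDerivAt (fun t => Uact n Φ (γ t)) (Uact n Φ₁ (γ 0) - I * Uact n Φ₂ (γ 0)) 0 := by
  obtain ⟨C₁, hC₁, h₁⟩ := exists_norm_uIntegrand_le Φ₁
  obtain ⟨C₂, hC₂, h₂⟩ := exists_norm_uIntegrand_le Φ₂
  have hi₁ := integrable_uIntegrand Φ₁ (γ 0)
  have hi₂ := (integrable_uIntegrand Φ₂ (γ 0)).const_mul I
  have hb : ∀ ξ, ∀ s ∈ Metric.ball (0 : ℝ) 1,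
      ‖uIntegrand n Φ₁ (γ s) ξ - I * uIntegrand n Φ₂ (γ s) ξ‖ ≤
        (C₁ + C₂) * (2 * (1 + R)) ^ (n + 1) * decayWeight n ξ := fun ξ s hs => by
    have hw := decayWeight_nonneg ξ
    have hR := hγ s hs
    refine (norm_sub_le _ _).trans ?_
    rw [norm_mul, norm_I, one_mul, add_mul, add_mul]
    refine add_le_add ((h₁ _ _).trans ?_) ((h₂ _ _).trans ?_) <;> gcongr
  have h := (hasDerivAt_integral_of_dominated_loc_of_deriv_le (μ := volume) (x₀ := (0 : ℝ))
    (F := fun t => uIntegrand n Φ (γ t)) (Metric.ball_mem_nhds 0 one_pos)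
    (.of_forall fun s => aestronglyMeasurable_uIntegrand Φ _)
    (integrable_uIntegrand Φ _) (hi₁.sub hi₂).aestronglyMeasurable
    (.of_forall hb) ((integrable_decayWeight n).const_mul _)
    (.of_forall fun ξ s _ => hd ξ s)).2
  rw [integral_sub hi₁ hi₂, integral_const_mul] at h
  refine (h.const_mul ((Real.sqrt ((2 * Real.pi) ^ n) : ℝ) : ℂ)⁻¹).congr_deriv ?_
  simp only [Uact, uIntegrand]
  ring

lemma hasDerivAt_Uact_fst {n : ℕ} (Φ : SchwartzMap (Phase n) ℂ) (j : Fin n) (x p : Cfg n) :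
    HasDerivAt (fun t : ℝ => Uact n Φ (x + t • Pi.single j 1, p))
      (Uact n (derivX j Φ) (x, p) - I * Uact n (mulP j Φ) (x, p)) 0 := by
  have h := hasDerivAt_Uact_comp Φ (derivX j Φ) (mulP j Φ)
    (fun t => (x + t • Pi.single j 1, p)) (R := ‖x‖ + 1) (fun s hs => ?_) (fun ξ s => ?_)
  · simpa only [zero_smul, add_zero] using h
  · refine (norm_add_le _ _).trans ?_
    rw [norm_smul, Pi.norm_single, norm_one, mul_one]
    gcongr
    simpa using (Metric.mem_ball.1 hs).le
  · have h := (hasDerivAt_Fp Φ j 1 1 (x - (1 / 2 : ℝ) • ξ) (x + (1 / 2 : ℝ) • ξ) s).const_mul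
      (exp (I * ((dotp n ξ p : ℝ) : ℂ)))
    simp only [mul_one, Complex.ofReal_one, one_mul, sub_add_eq_add_sub,
      add_right_comm x _ (_ • Pi.single j 1)] at h
    refine h.congr_deriv ?_
    simp only [uIntegrand]
    ring

lemma I_mul_uIntegrand {n : ℕ} (Φ : SchwartzMap (Phase n) ℂ) (j : Fin n) (z : Phase n)
    (ξ : Cfg n) :
    I * ξ j * uIntegrand n Φ z ξ =
      uIntegrand n (derivP j Φ) z ξ - I * uIntegrand n (mulX j Φ) z ξ := by
  simp only [uIntegrand, Fp_derivP, Fp_mulX, Pi.add_apply, Pi.sub_apply, Pi.smul_apply,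
    smul_eq_mul]
  push_cast
  ring

lemma hasDerivAt_Uact_snd {n : ℕ} (Φ : SchwartzMap (Phase n) ℂ) (j : Fin n) (x p : Cfg n) :
    HasDerivAt (fun t : ℝ => Uact n Φ (x, p + t • Pi.single j 1))
      (Uact n (derivP j Φ) (x, p) - I * Uact n (mulX j Φ) (x, p)) 0 := by
  have h := hasDerivAt_Uact_comp Φ (derivP j Φ) (mulX j Φ)
    (fun t => (x, p + t • Pi.single j 1)) (R := ‖x‖) (fun s _ => le_rfl)
    (fun ξ s => ?_)
  · simpa only [zero_smul, add_zero] using h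
  · simp only [← I_mul_uIntegrand]
    simp only [uIntegrand, dotp_add_smul_single, ← mul_assoc]
    exact (hasDerivAt_exp_I_mul _ _ s).mul_const _

lemma hasLineDerivAt_Fp {n : ℕ} (Φ : SchwartzMap (Phase n) ℂ) (j : Fin n) (x ξ : Cfg n) :
    HasLineDerivAt ℝ (fun ξ => Fp n Φ (x - (1 / 2 : ℝ) • ξ, x + (1 / 2 : ℝ) • ξ))
      (-1 / 2 * Fp n (derivX j Φ) (x - (1 / 2 : ℝ) • ξ, x + (1 / 2 : ℝ) • ξ) -
        I / 2 * Fp n (mulP j Φ) (x - (1 / 2 : ℝ) • ξ, x + (1 / 2 : ℝ) • ξ))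
      ξ (Pi.single j 1) := by
  have h := hasDerivAt_Fp Φ j (-1 / 2) (1 / 2) (x - (1 / 2 : ℝ) • ξ) (x + (1 / 2 : ℝ) • ξ) 0
  have h₁ : ∀ t : ℝ, x - (1 / 2 : ℝ) • (ξ + t • Pi.single j 1) =
      x - (1 / 2 : ℝ) • ξ + (t * (-1 / 2)) • Pi.single j 1 := fun t => by module
  have h₂ : ∀ t : ℝ, x + (1 / 2 : ℝ) • (ξ + t • Pi.single j 1) =
      x + (1 / 2 : ℝ) • ξ + (t * (1 / 2)) • Pi.single j 1 := fun t => by module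
  simp only [zero_mul, zero_smul, add_zero] at h
  simp only [HasLineDerivAt, h₁, h₂]
  refine h.congr_deriv ?_
  push_cast
  ring

lemma I_mul_Uact {n : ℕ} (Φ : SchwartzMap (Phase n) ℂ) (j : Fin n) (x p : Cfg n) :
    I * p j * Uact n Φ (x, p) =
      1 / 2 * (Uact n (derivX j Φ) (x, p) + I * Uact n (mulP j Φ) (x, p)) := by
  have hi₁ := (integrable_uIntegrand (derivX j Φ) (x, p)).const_mul (-1 / 2)
  have hi₂ := (integrable_uIntegrand (mulP j Φ) (x, p)).const_mul (I / 2)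
  have hθ : ∀ ξ, HasLineDerivAt ℝ (fun ξ => exp (I * ((dotp n ξ p : ℝ) : ℂ)))
      (I * p j * exp (I * ((dotp n ξ p : ℝ) : ℂ))) ξ (Pi.single j 1) := fun ξ => by
    have := hasDerivAt_exp_I_mul (dotp n ξ p) (p j) 0
    simpa only [HasLineDerivAt, dotp_add_smul_single_left, zero_mul, add_zero] using this
  have hg : ∀ ξ : Cfg n, exp (I * ((dotp n ξ p : ℝ) : ℂ)) *
      (-1 / 2 * Fp n (derivX j Φ) (x - (1 / 2 : ℝ) • ξ, x + (1 / 2 : ℝ) • ξ) -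
        I / 2 * Fp n (mulP j Φ) (x - (1 / 2 : ℝ) • ξ, x + (1 / 2 : ℝ) • ξ)) =
      -1 / 2 * uIntegrand n (derivX j Φ) (x, p) ξ -
        I / 2 * uIntegrand n (mulP j Φ) (x, p) ξ := fun ξ => by
    simp only [uIntegrand]
    ring
  have h := integral_mul_hasLineDerivAt_of_eigen hθ (hasLineDerivAt_Fp Φ j x)
    (integrable_uIntegrand Φ (x, p)) ((hi₁.sub hi₂).congr (.of_forall fun ξ => (hg ξ).symm))
  rw [integral_congr_ae (.of_forall hg), integral_sub hi₁ hi₂, integral_const_mul,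
    integral_const_mul] at h
  simp only [Uact, uIntegrand] at h ⊢
  linear_combination ((Real.sqrt ((2 * Real.pi) ^ n) : ℝ) : ℂ)⁻¹ * h

lemma coord_mul_Uact {n : ℕ} (Φ : SchwartzMap (Phase n) ℂ) (j : Fin n) (x p : Cfg n) :
    x j * Uact n Φ (x, p) =
      1 / 2 * (Uact n (mulX j Φ) (x, p) - I * Uact n (derivP j Φ) (x, p)) := by
  have hi₁ := integrable_uIntegrand (mulX j Φ) (x, p)
  have hi₂ := (integrable_uIntegrand (derivP j Φ) (x, p)).const_mul I
  have h : ∀ ξ, x j * uIntegrand n Φ (x, p) ξ = 1 / 2 *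
      (uIntegrand n (mulX j Φ) (x, p) ξ - I * uIntegrand n (derivP j Φ) (x, p) ξ) := fun ξ => by
    simp only [uIntegrand, Fp_derivP, Fp_mulX, Pi.add_apply, Pi.sub_apply, Pi.smul_apply,
      smul_eq_mul]
    push_cast
    linear_combination (1 / 2 * (x j + 1 / 2 * ξ j) * exp (I * ((dotp n ξ p : ℝ) : ℂ)) *
      Fp n Φ (x - (1 / 2 : ℝ) • ξ, x + (1 / 2 : ℝ) • ξ)) * I_mul_I
  have h' := integral_congr_ae (μ := volume) (.of_forall h)
  rw [integral_const_mul, integral_const_mul, integral_sub hi₁ hi₂, integral_const_mul] at h'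
  simp only [Uact, uIntegrand] at h' ⊢
  linear_combination (((Real.sqrt ((2 * Real.pi) ^ n) : ℝ) : ℂ)⁻¹) * h'

lemma deriv_update_of_hasDerivAt {n : ℕ} {f : Cfg n → ℂ} {j : Fin n} {x : Cfg n} {f' : ℂ}
    (h : HasDerivAt (fun t : ℝ => f (x + t • Pi.single j 1)) f' 0) :
    deriv (fun t : ℝ => f (Function.update x j t)) (x j) = f' := by
  simp only [update_eq_add_smul_single]
  rw [← sub_self (x j)] at h
  exact (h.comp_sub_const (x j) (x j)).deriv

lemma deriv_schwartz_update_fst {n : ℕ} (Φ : SchwartzMap (Phase n) ℂ) (j : Fin n)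
    (w : Phase n) :
    deriv (fun t : ℝ => Φ (Function.update w.1 j t, w.2)) (w.1 j) = derivX j Φ w := by
  refine deriv_update_of_hasDerivAt (f := fun y => Φ (y, w.2)) ?_
  simpa using hasDerivAt_schwartz_smul_single Φ j 1 0 w.1 w.2 0

lemma deriv_schwartz_update_snd {n : ℕ} (Φ : SchwartzMap (Phase n) ℂ) (j : Fin n)
    (w : Phase n) :
    deriv (fun t : ℝ => Φ (w.1, Function.update w.2 j t)) (w.2 j) = derivP j Φ w := by
  refine deriv_update_of_hasDerivAt (f := fun y => Φ (w.1, y)) ?_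
  simpa using hasDerivAt_schwartz_smul_single Φ j 0 1 w.1 w.2 0

/-- Bopp shifts: U conjugates the fundamental phase-space Schrödinger operators into the
Moyal representation.  Writing Ψ = UΦ (so Φ = U⁻¹Ψ), for each j:
U(x_j U⁻¹Ψ) = x_jΨ + (i/2)∂Ψ/∂p_j,  U(p_j U⁻¹Ψ) = p_jΨ + (i/2)∂Ψ/∂x_j,
U(−i∂_{x_j}U⁻¹Ψ) = p_jΨ − (i/2)∂Ψ/∂x_j,  U(−i∂_{p_j}U⁻¹Ψ) = x_jΨ − (i/2)∂Ψ/∂p_j. -/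
theorem Bopp_shifts (n : ℕ) (Φ : SchwartzMap (Phase n) ℂ) (j : Fin n) (x p : Cfg n) :
    (Uact n (fun zp : Phase n => (zp.1 j : ℂ) * Φ zp) (x, p)
      = (x j : ℂ) * Uact n (⇑Φ) (x, p)
        + Complex.I / 2 *
          deriv (fun u : ℝ => Uact n (⇑Φ) (x, Function.update p j u)) (p j)) ∧
    (Uact n (fun zp : Phase n => (zp.2 j : ℂ) * Φ zp) (x, p)
      = (p j : ℂ) * Uact n (⇑Φ) (x, p)
        + Complex.I / 2 *
          deriv (fun t : ℝ => Uact n (⇑Φ) (Function.update x j t, p)) (x j)) ∧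
    (Uact n (fun zp : Phase n =>
        -Complex.I * deriv (fun t : ℝ => Φ (Function.update zp.1 j t, zp.2)) (zp.1 j)) (x, p)
      = (p j : ℂ) * Uact n (⇑Φ) (x, p)
        - Complex.I / 2 *
          deriv (fun t : ℝ => Uact n (⇑Φ) (Function.update x j t, p)) (x j)) ∧
    (Uact n (fun zp : Phase n =>
        -Complex.I * deriv (fun u : ℝ => Φ (zp.1, Function.update zp.2 j u)) (zp.2 j)) (x, p)
      = (x j : ℂ) * Uact n (⇑Φ) (x, p)
        - Complex.I / 2 *
          deriv (fun u : ℝ => Uact n (⇑Φ) (x, Function.update p j u)) (p j)) := by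
  have hX : (fun zp : Phase n => (zp.1 j : ℂ) * Φ zp) = mulX j Φ :=
    funext fun zp => (mulX_apply j Φ zp).symm
  have hP : (fun zp : Phase n => (zp.2 j : ℂ) * Φ zp) = mulP j Φ :=
    funext fun zp => (mulP_apply j Φ zp).symm
  have hDX : (fun zp : Phase n =>
      deriv (fun t : ℝ => Φ (Function.update zp.1 j t, zp.2)) (zp.1 j)) = derivX j Φ :=
    funext fun zp => deriv_schwartz_update_fst Φ j zp
  have hDP : (fun zp : Phase n =>
      deriv (fun u : ℝ => Φ (zp.1, Function.update zp.2 j u)) (zp.2 j)) = derivP j Φ :=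
    funext fun zp => deriv_schwartz_update_snd Φ j zp
  have hx := deriv_update_of_hasDerivAt (f := fun y => Uact n Φ (y, p))
    (hasDerivAt_Uact_fst Φ j x p)
  have hp := deriv_update_of_hasDerivAt (f := fun y => Uact n Φ (x, y))
    (hasDerivAt_Uact_snd Φ j x p)
  have hIp := I_mul_Uact Φ j x p
  have hxU := coord_mul_Uact Φ j x p
  have hpU : (p j : ℂ) * Uact n Φ (x, p) =
      1 / 2 * (Uact n (mulP j Φ) (x, p) - I * Uact n (derivX j Φ) (x, p)) := by
    linear_combination (-I) * hIp + (p j * Uact n Φ (x, p) -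
      1 / 2 * Uact n (mulP j Φ) (x, p)) * I_mul_I
  rw [hX, hP, Uact_const_mul, Uact_const_mul, hDX, hDP, hx, hp, hxU, hpU]
  refine ⟨?_, ?_, ?_, ?_⟩
  · linear_combination (1 / 2 * Uact n (mulX j Φ) (x, p)) * I_mul_I
  · linear_combination (1 / 2 * Uact n (mulP j Φ) (x, p)) * I_mul_I
  · linear_combination (-1 / 2 * Uact n (mulP j Φ) (x, p)) * I_mul_I
  · linear_combination (-1 / 2 * Uact n (mulX j Φ) (x, p)) * I_mul_I
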